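/- Fix z ∈ ℂ*, η ∈ ℂ, and t₀ ∈ ℂ* with Re(t₀/z) > 0. Then Λ(z/(2πi·r·t₀), η) → 1 as r → 0 through positive reals. (This expresses the limiting condition Ψ(t) → id as t → 0 along rays, satisfied by the solution of the quantum Riemann-Hilbert problem for the doubled A₁ refined BPS structure.) -/

import Mathlib

open Filter

/-- The modified gamma function (with `ω = 1`):
`Λ(w,η) = Γ(w+η) · exp(w) / (√(2π) · exp((η + w − 1/2)·Log w))`,
where `Log` is the principal branch of the logarithm. -/
noncomputable def Lambda (w η : ℂ) : ℂ :=
  Complex.Gamma (w + η) * Complex.exp w /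
    ((Real.sqrt (2 * Real.pi) : ℂ) * Complex.exp ((η + w - 1 / 2) * Complex.log w))


noncomputable def gtermL (s : ℂ) : ℂ := (s + 1/2) * (Complex.log (s+1) - Complex.log s) - 1

noncomputable def FL (s : ℂ) : ℂ := (s - 1/2) * Complex.log s - s

lemma lim_log_diff (u a b : ℂ) (hu : u ∈ Complex.slitPlane) :
    Tendsto (fun R : ℝ => ((R:ℂ) * u + b) * (Complex.log ((R:ℂ) * u + a) - Complex.log ((R:ℂ) * u)))
      atTop (nhds a) := by
  have hu0 : u ≠ 0 := Complex.slitPlane_ne_zero hu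
  have hinv : Tendsto (fun R : ℝ => ((R⁻¹ : ℝ):ℂ)) atTop (nhds 0) := by
    have := (Complex.continuous_ofReal.tendsto 0).comp (tendsto_inv_atTop_zero (𝕜 := ℝ))
    simpa [Function.comp_def] using this
  have hd : HasDerivAt (fun t : ℝ => Complex.log (u + (t:ℂ) * a)) (a / u) 0 := by
    have h1 : HasDerivAt (fun t : ℝ => u + (t:ℂ) * a) a 0 := by
      have := ((Complex.ofRealCLM.hasDerivAt (x := (0:ℝ))).mul_const a).const_add u
      simpa using this
    have := h1.clog_real (by simpa using hu)
    simpa using this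
  have hs := hd.tendsto_slope_zero
  have hinv' : Tendsto (fun R : ℝ => R⁻¹) atTop (nhdsWithin 0 {0}ᶜ) := by
    refine tendsto_nhdsWithin_iff.2 ⟨tendsto_inv_atTop_zero, ?_⟩
    filter_upwards [eventually_gt_atTop 0] with R hR
    simp [hR.ne']
  have hs2 := hs.comp hinv'
  have h3 : Tendsto (fun R : ℝ => u + ((R⁻¹ : ℝ):ℂ) * b) atTop (nhds (u + 0 * b)) :=
    (hinv.mul_const b).const_add u
  have h4 := h3.mul hs2
  have e : (u + 0 * b) * (a / u) = a := by field_simp; ring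
  rw [e] at h4
  refine h4.congr' ?_
  filter_upwards [eventually_gt_atTop 0, 
    (show Tendsto (fun R : ℝ => u + ((R⁻¹ : ℝ):ℂ) * a) atTop (nhds (u + 0 * a)) from
    (hinv.mul_const a).const_add u).eventually_ne (b₂ := 0) (by simpa using hu0)] with R hR hne
  have hR' : (R:ℂ) ≠ 0 := by exact_mod_cast hR.ne'
  have e1 : (R:ℂ) * u + a = (R:ℂ) * (u + ((R⁻¹ : ℝ):ℂ) * a) := by
    push_cast; field_simp
  rw [e1, Complex.log_ofReal_mul hR hne, Complex.log_ofReal_mul hR hu0]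
  simp
  field_simp

lemma log_succ (s : ℂ) (hs : s.im < 0) :
    Complex.log (s+1) - Complex.log s = Complex.log (1 + s⁻¹) := by
  have h0 : s ≠ 0 := by rintro rfl; simp at hs
  have h1 : s + 1 ≠ 0 := by intro h; have := congrArg Complex.im h; simp at this; linarith
  have e : 1 + s⁻¹ = Complex.exp (Complex.log (s+1) - Complex.log s) := by
    rw [Complex.exp_sub, Complex.exp_log h0, Complex.exp_log h1]; field_simp
  have a1 : Complex.arg s < 0 := Complex.arg_neg_iff.2 hs
  have a2 : Complex.arg (s+1) < 0 := Complex.arg_neg_iff.2 (by simpa using hs)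
  have a3 := Complex.neg_pi_lt_arg s
  have a4 := Complex.neg_pi_lt_arg (s+1)
  rw [e, Complex.log_exp]
  · simp only [Complex.sub_im, Complex.log_im]; linarith
  · simp only [Complex.sub_im, Complex.log_im]; linarith

lemma gterm_bound (s : ℂ) (hs : s.im < 0) (h2 : 2 ≤ ‖s‖) : ‖gtermL s‖ ≤ 2 / ‖s‖^2 := by
  have h0 : s ≠ 0 := by rintro rfl; simp at hs
  obtain ⟨z, rfl⟩ : ∃ z : ℂ, s = z⁻¹ := ⟨s⁻¹, by simp⟩
  have hz : z ≠ 0 := by simpa using h0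
  have hzp : 0 < ‖z‖ := norm_pos_iff.2 hz
  have hz2 : ‖z‖ ≤ 1/2 := by
    rw [norm_inv] at h2
    rw [le_inv_comm₀ (by norm_num) hzp] at h2
    linarith
  unfold gtermL
  rw [log_succ _ hs, inv_inv]
  have hb := Complex.norm_log_sub_logTaylor_le 2 (z := z) (by linarith)
  have ht : Complex.logTaylor (2+1) z = z - z^2/2 := by
    simp [Complex.logTaylor, Finset.sum_range_succ]; ring
  rw [ht] at hb
  set E := Complex.log (1+z) - (z - z^2/2) with hE
  have e : (z⁻¹ + 1/2) * Complex.log (1+z) - 1 = -z^2/4 + (z⁻¹ + 1/2) * E := by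
    rw [hE]; field_simp; ring
  have hi : (1 - ‖z‖)⁻¹ ≤ 2 := by
    rw [inv_le_comm₀ (by linarith) (by norm_num)]; linarith
  have hb' : ‖E‖ ≤ ‖z‖^3 := by
    refine hb.trans ?_
    have : 0 ≤ ‖z‖^3 := by positivity
    norm_num
    nlinarith
  rw [e]
  have n1 : ‖z⁻¹ + 1/2‖ ≤ ‖z‖⁻¹ + 1/2 := by
    refine (norm_add_le _ _).trans ?_
    simp
  have n2 : ‖-z^2/4‖ = ‖z‖^2/4 := by simp
  calc ‖-z^2/4 + (z⁻¹ + 1/2) * E‖ ≤ ‖z‖^2/4 + (‖z‖⁻¹ + 1/2) * ‖z‖^3 := by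
        refine (norm_add_le _ _).trans ?_
        rw [n2, norm_mul]
        gcongr
    _ = ‖z‖^2/4 + ‖z‖^2 + ‖z‖^3/2 := by field_simp; ring
    _ ≤ 2 * ‖z‖^2 := by nlinarith [sq_nonneg ‖z‖]
    _ = _ := by simp

lemma ray_bound (c η : ℂ) (hc : c.im < 0) : ∃ δ > 0, ∀ᶠ R : ℝ in atTop, ∀ k : ℕ,
    ((R:ℂ) * c + η + k).im < 0 ∧ δ * (R + k) ≤ ‖(R:ℂ) * c + η + k‖ := by
  set b := -c.im with hb
  have hbp : 0 < b := by linarith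
  set K := 1 + (‖c‖ + 1)/b with hK
  have hKp : 0 < K := by positivity
  have hX : ∀ R : ℝ, 0 < R → ∀ k : ℕ, R + k ≤ K * ‖(R:ℂ) * c + k‖ := by
    intro R hR k
    have h1 : R * b ≤ ‖(R:ℂ) * c + k‖ := by
      have := Complex.abs_im_le_norm ((R:ℂ) * c + k)
      have e : ((R:ℂ) * c + k).im = -(R * b) := by simp [hb]
      rw [e, abs_neg] at this
      exact (le_abs_self _).trans this
    have h2 : (k:ℝ) - R * ‖c‖ ≤ ‖(R:ℂ) * c + k‖ := by
      have := norm_sub_le ((R:ℂ) * c + k) ((R:ℂ) * c)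
      simp only [add_sub_cancel_left, norm_mul, Complex.norm_natCast, Complex.norm_real,
        Real.norm_eq_abs, abs_of_pos hR] at this
      linarith
    have h3 : R ≤ ‖(R:ℂ) * c + k‖ / b := by rwa [le_div_iff₀ hbp]
    have h4 : K * ‖(R:ℂ) * c + k‖ = ‖(R:ℂ) * c + k‖ + (‖c‖+1) * (‖(R:ℂ) * c + k‖ / b) := by
      rw [hK]; ring
    rw [h4]
    nlinarith [norm_nonneg c]
  refine ⟨(2*K)⁻¹, by positivity, ?_⟩
  filter_upwards [eventually_gt_atTop 0, eventually_gt_atTop (‖η‖ / b),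
    eventually_ge_atTop (2 * K * ‖η‖)] with R hR h1 h2 k
  constructor
  · have := (le_abs_self _).trans (Complex.abs_im_le_norm η)
    rw [div_lt_iff₀ hbp] at h1
    simp
    nlinarith
  · have h3 := hX R hR k
    have h4 : ‖(R:ℂ) * c + k‖ ≤ ‖(R:ℂ) * c + η + k‖ + ‖η‖ := by
      have := norm_sub_le ((R:ℂ) * c + η + k) η
      rwa [show (R:ℂ) * c + η + k - η = (R:ℂ) * c + k by ring] at this
    rw [inv_mul_le_iff₀ (by positivity)]
    have : (0:ℝ) ≤ k := by positivity
    nlinarith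

lemma prod_eq (s : ℂ) (hs : s.im < 0) (n : ℕ) :
    ∏ j ∈ Finset.range n, (s + j) =
      Complex.exp (FL (s + n) - FL s - ∑ k ∈ Finset.range n, gtermL (s + k)) := by
  induction n with
  | zero => simp
  | succ n ih =>
    have h1 : s + n ≠ 0 := by intro h; have := congrArg Complex.im h; simp at this; linarith
    rw [Finset.prod_range_succ, ih, Finset.sum_range_succ]
    nth_rewrite 2 [← Complex.exp_log h1]
    rw [← Complex.exp_add]
    congr 1
    simp only [FL, gtermL]
    push_cast
    rw [← add_assoc]
    ring

lemma stirling_lim (s : ℂ) : Tendsto (fun n : ℕ => (n:ℂ)^s * (n.factorial : ℂ) *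
    Complex.exp (-FL (s + (n+1:ℕ)))) atTop (nhds ((Real.sqrt (2 * Real.pi) : ℝ) : ℂ)) := by
  have h1 := (Complex.continuous_ofReal.tendsto _).comp Stirling.tendsto_stirlingSeq_sqrt_pi
  have h2 := (lim_log_diff 1 (s+1) (s+1/2) (by simp)).comp (tendsto_natCast_atTop_atTop (R := ℝ))
  have h3 := (Complex.continuous_exp.tendsto _).comp (h2.const_sub (s+1))
  have h4 := (h1.mul h3).const_mul ((Real.sqrt 2 : ℝ):ℂ)
  have e : ((Real.sqrt 2 : ℝ):ℂ) * (((Real.sqrt Real.pi : ℝ):ℂ) * Complex.exp (s + 1 - (s+1))) =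
    ((Real.sqrt (2 * Real.pi) : ℝ) : ℂ) := by
    rw [Real.sqrt_mul (by norm_num)]; simp
  rw [e] at h4
  refine h4.congr' ?_
  filter_upwards [eventually_gt_atTop 0] with n hn
  have hnR : (0:ℝ) < n := by exact_mod_cast hn
  have hnC : (n:ℂ) ≠ 0 := by exact_mod_cast hn.ne'
  have hst : Real.sqrt 2 * Stirling.stirlingSeq n =
      n.factorial * Real.exp (-(1/2 * Real.log n) - n * Real.log n + n) := by
    have q1 : Real.sqrt (n:ℝ) = Real.exp (1/2 * Real.log n) := by
      rw [Real.sqrt_eq_rpow, Real.rpow_def_of_pos hnR, mul_comm]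
    have q2 : ((n:ℝ) / Real.exp 1)^n = Real.exp (n * Real.log n - n) := by
      rw [div_pow, Real.exp_sub, ← Real.exp_nat_mul, mul_one, Real.exp_nat_mul, Real.exp_log hnR]
    rw [Stirling.stirlingSeq, Real.sqrt_mul (by norm_num), q1, q2,
      show -(1/2 * Real.log n) - n * Real.log n + n =
        -((1/2 * Real.log n) + (n * Real.log n - n)) by ring, Real.exp_neg, Real.exp_add]
    field_simp
  simp only [Function.comp]
  rw [← mul_assoc, ← Complex.ofReal_mul, hst, Complex.cpow_def_of_ne_zero hnC]
  push_cast
  rw [mul_right_comm, mul_comm (Complex.exp _) (n.factorial : ℂ)] 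
  rw [mul_assoc, mul_assoc, ← Complex.exp_add, ← Complex.exp_add]
  congr 2
  simp only [FL, mul_one]
  rw [show (n:ℂ) + (s+1) = s + (n+1) by ring]
  ring

lemma gamma_eq (s : ℂ) (hs : s.im < 0) (hsum : Summable (fun k : ℕ => gtermL (s + k))) :
    Complex.Gamma s = (Real.sqrt (2 * Real.pi) : ℝ) * Complex.exp (FL s + ∑' k : ℕ, gtermL (s + k)) := by
  have h1 := Complex.GammaSeq_tendsto_Gamma s
  have h2 := (hsum.hasSum.tendsto_sum_nat.comp (tendsto_add_atTop_nat 1)).const_add (FL s)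
  have h3 := (stirling_lim s).mul ((Complex.continuous_exp.tendsto _).comp h2)
  refine tendsto_nhds_unique h1 (h3.congr ?_)
  intro n
  simp only [Function.comp, Complex.GammaSeq]
  rw [prod_eq s hs, div_eq_mul_inv, ← Complex.exp_neg, mul_assoc, ← Complex.exp_add]
  congr 2
  ring

lemma ray_lim (c η : ℂ) (hc : c.im < 0) :
    Tendsto (fun R : ℝ => ∑' k : ℕ, gtermL ((R:ℂ) * c + η + k)) atTop (nhds 0) ∧
    ∀ᶠ R : ℝ in atTop, ((R:ℂ) * c + η).im < 0 ∧ Summable (fun k : ℕ => gtermL ((R:ℂ) * c + η + k)) := by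
  obtain ⟨δ, hδ, h⟩ := ray_bound c η hc
  have hb : ∀ᶠ R : ℝ in atTop, ∀ k : ℕ, ‖gtermL ((R:ℂ) * c + η + k)‖ ≤ 2 / (δ * (R + k))^2 := by
    filter_upwards [h, eventually_ge_atTop (2/δ), eventually_gt_atTop 0] with R hR h2 h0 k
    obtain ⟨h3, h4⟩ := hR k
    rw [div_le_iff₀ hδ] at h2
    have h5 : (0:ℝ) ≤ k := by positivity
    have h6 : 2 ≤ δ * (R + k) := by nlinarith
    refine (gterm_bound _ h3 (h6.trans h4)).trans ?_
    gcongr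
  have hb2 : ∀ᶠ R : ℝ in atTop, ∀ k : ℕ, ‖gtermL ((R:ℂ) * c + η + k)‖ ≤ 2 / δ^2 * (1 / ((k+1 : ℕ) : ℝ)^2) := by
    filter_upwards [hb, eventually_ge_atTop 1] with R hR h1 k
    refine (hR k).trans ?_
    have : 2 / δ^2 * (1 / ((k+1 : ℕ) : ℝ)^2) = 2 / (δ * (1 + k))^2 := by
      push_cast; field_simp; ring
    rw [this]
    gcongr
  have hS : Summable (fun k : ℕ => 2 / δ^2 * (1 / ((k+1 : ℕ) : ℝ)^2)) :=
    ((summable_nat_add_iff 1).2 (Real.summable_one_div_nat_pow.2 (by norm_num : 1 < 2))).mul_left _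
  constructor
  · have := tendsto_tsum_of_dominated_convergence (𝓕 := atTop) (f := fun (R:ℝ) (k : ℕ) => gtermL ((R:ℂ) * c + η + k))
      (g := fun _ => 0) hS ?_ hb2
    · simpa using this
    · intro k
      have hl : Tendsto (fun R : ℝ => 2 / (δ * (R + k))^2) atTop (nhds 0) := by
        refine Tendsto.const_div_atTop ?_ 2
        exact (tendsto_pow_atTop (by norm_num)).comp
          ((tendsto_atTop_add_const_right _ _ tendsto_id).const_mul_atTop hδ)
      refine squeeze_zero_norm' ?_ hl
      filter_upwards [hb] with R hR using hR k
  · filter_upwards [h, hb2] with R hR h2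
    exact ⟨by simpa using (hR 0).1, Summable.of_norm_bounded hS h2⟩

lemma lambda_ray (c η : ℂ) (hc : c.im < 0) :
    Tendsto (fun R : ℝ => Lambda ((R:ℂ) * c) η) atTop (nhds 1) := by
  obtain ⟨h1, h2⟩ := ray_lim c η hc
  have h3 := lim_log_diff c η (η - 1/2) (Or.inr hc.ne)
  have h4 := (Complex.continuous_exp.tendsto _).comp (h1.add (h3.sub_const η))
  rw [sub_self, add_zero, Complex.exp_zero] at h4
  refine h4.congr' ?_
  filter_upwards [h2] with R hR
  have hp : ((Real.sqrt (2 * Real.pi) : ℝ) : ℂ) ≠ 0 := by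
    have : 0 < Real.sqrt (2 * Real.pi) := Real.sqrt_pos.2 (by positivity)
    exact_mod_cast this.ne'
  simp only [Function.comp]
  rw [Lambda, gamma_eq _ hR.1 hR.2, mul_assoc, mul_div_mul_left _ _ hp, ← Complex.exp_add,
    ← Complex.exp_sub]
  congr 1
  simp only [FL]
  ring

/-- (The limiting condition `Ψ(t) → id` as `t → 0` along rays, for the
quantum Riemann–Hilbert problem of the doubled A₁ refined BPS structure.)
Fix `z ∈ ℂ*`, `η ∈ ℂ`, and `t₀ ∈ ℂ*` with `Re(t₀/z) > 0`.  Then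
`Λ(z/(2πi·r·t₀), η) → 1` as `r → 0` through positive reals. -/
theorem lambda_limit_at_zero (z t₀ η : ℂ) (hz : z ≠ 0) (ht₀ : t₀ ≠ 0)
    (hre : 0 < (t₀ / z).re) :
    Tendsto (fun r : ℝ => Lambda (z / (2 * Real.pi * Complex.I * (r : ℂ) * t₀)) η)
      (nhdsWithin 0 (Set.Ioi 0)) (nhds 1) := by
  set c : ℂ := z / (2 * Real.pi * Complex.I * t₀) with hcdef
  have hc : c.im < 0 := by
    have e : c = -Complex.I * (((2 * Real.pi)⁻¹ : ℝ) : ℂ) * (t₀ / z)⁻¹ := by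
      have hpi : (Real.pi : ℂ) ≠ 0 := by exact_mod_cast Real.pi_ne_zero
      rw [hcdef]
      push_cast
      field_simp
      simp
    have hp : 0 < ((t₀ / z)⁻¹).re := by
      rw [Complex.inv_re]
      exact div_pos hre (Complex.normSq_pos.2 (div_ne_zero ht₀ hz))
    have e2 : c.im = -((2 * Real.pi)⁻¹ * ((t₀ / z)⁻¹).re) := by
      rw [e, mul_assoc, neg_mul, Complex.neg_im, Complex.I_mul_im, Complex.re_ofReal_mul]
    rw [e2]
    have : 0 < (2 * Real.pi)⁻¹ := by positivity
    linarith [mul_pos this hp]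
  refine ((lambda_ray c η hc).comp tendsto_inv_nhdsGT_zero).congr ?_
  intro r
  simp only [Function.comp]
  congr 1
  rw [hcdef]
  push_cast
  simp only [div_eq_mul_inv, mul_inv]
  ring
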